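/- arXiv:1910.04258 — 2 statements merged into one kernel-verified Lean document; each statement's English description precedes it below -/
import Mathlib

section
/- For an a-riffle shuffle of n cards started at the identity, with transition probability P_{n,a}(w) = C(n + a - des(w^{-1}) - 1, n)/a^n, the probability of obtaining an even permutation equals 1/2 + 1/(2a^{⌊n/2⌋}); that is, ∑_{w ∈ S_n, sgn(w)=1} C(n + a - des(w^{-1}) - 1, n)/a^n = 1/2 + 1/(2a^{⌊n/2⌋}). -/
open scoped Classical

/-- Number of descents of a permutation of `{0,…,n-1}`. -/
noncomputable def desA {n : ℕ} (w : Equiv.Perm (Fin n)) : ℕ :=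
  ((Finset.range (n - 1)).filter (fun i =>
    ∃ h : i + 1 < n, w ⟨i + 1, h⟩ < w ⟨i, Nat.lt_of_succ_lt h⟩)).card

/-- Number of inversions of a permutation. -/
noncomputable def invA {n : ℕ} (w : Equiv.Perm (Fin n)) : ℕ :=
  (Finset.univ.filter (fun p : Fin n × Fin n => p.1 < p.2 ∧ w p.2 < w p.1)).card

/-- The sign of a word: `-1` to the number of its inversions. -/
def wordSign {α : Type*} [LinearOrder α] {n : ℕ} (g : Fin n → α) : ℤ :=
  ∏ i, ∏ j ∈ Finset.Ioi i, if g i ≤ g j then 1 else -1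

theorem wordSign_cons {α : Type*} [LinearOrder α] {n : ℕ} (x : α) (g : Fin n → α) :
    wordSign (Fin.cons x g : Fin (n + 1) → α) =
      (∏ j, if x ≤ g j then 1 else -1) * wordSign g := by
  simp [wordSign, Fin.prod_univ_succ, Fin.prod_Ioi_succ]

theorem sign_sort_eq_wordSign {α : Type*} [LinearOrder α] {n : ℕ} (g : Fin n → α) :
    (Equiv.Perm.sign (Tuple.sort g) : ℤ) = wordSign g := by
  obtain ⟨hmono, htie⟩ := Tuple.eq_sort_iff.1 (rfl : Tuple.sort g = Tuple.sort g)
  generalize Tuple.sort g = u at hmono htie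
  rw [← Equiv.Perm.sign_inv, Equiv.Perm.sign_eq_prod_prod_Ioi]
  simp only [Units.coe_prod, wordSign]
  refine Finset.prod_congr rfl fun i _ => Finset.prod_congr rfl fun j hj => ?_
  have hij : i < j := Finset.mem_Ioi.1 hj
  have key : u⁻¹ i < u⁻¹ j ↔ g i ≤ g j := by
    constructor
    · intro h
      simpa using hmono h.le
    · intro h
      by_contra! hlt
      have hlt' : u⁻¹ j < u⁻¹ i := lt_of_le_of_ne hlt (by simpa using hij.ne')
      have hle : g j ≤ g i := by simpa using hmono hlt'.le
      have := htie _ _ hlt' (by simpa using le_antisymm hle h)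
      exact lt_asymm (by simpa using this) hij
  simp only [key]
  split_ifs <;> rfl

theorem sum_sum_mul_eq_card {α : Type*} [LinearOrder α] [Fintype α] (F : α → ℤ)
    (hF : ∀ x, F x * F x = 1) :
    ∑ x, ∑ y, (if x ≤ y then 1 else -1) * (F x * F y) = Fintype.card α := by
  have hswap : ∑ x, ∑ y, (if x ≤ y then 1 else -1) * (F x * F y) =
      ∑ x, ∑ y, (if y ≤ x then 1 else -1) * (F x * F y) := by
    rw [Finset.sum_comm]
    exact Finset.sum_congr rfl fun x _ => Finset.sum_congr rfl fun y _ => by rw [mul_comm (F y)]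
  have hdiag : ∑ x, ∑ y, (if x ≤ y then 1 else -1) * (F x * F y) +
      ∑ x, ∑ y, (if y ≤ x then 1 else -1) * (F x * F y) = 2 * Fintype.card α := by
    calc _ = ∑ x : α, ∑ y, if x = y then (2 : ℤ) else 0 := by
          simp only [← Finset.sum_add_distrib]
          refine Finset.sum_congr rfl fun x _ => Finset.sum_congr rfl fun y _ => ?_
          rcases lt_trichotomy x y with h | rfl | h
          · simp [h.le, h.not_ge, h.ne]
          · simp [hF]
          · simp [h.le, h.not_ge, h.ne']
      _ = _ := by simp [mul_comm]
  linarith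

theorem sum_wordSign (α : Type*) [LinearOrder α] [Fintype α] :
    ∀ n : ℕ, ∑ g : Fin n → α, wordSign g = (Fintype.card α : ℤ) ^ ((n + 1) / 2)
  | 0 => by simp [wordSign]
  | 1 => by simp [wordSign]
  | n + 2 => by
    rw [← (Fin.consEquiv fun _ : Fin (n + 2) => α).sum_comp, Fintype.sum_prod_type]
    have hinner (x : α) : ∑ g : Fin (n + 1) → α, wordSign (Fin.cons x g : Fin (n + 2) → α) =
        ∑ y, ∑ h : Fin n → α, wordSign (Fin.cons x (Fin.cons y h : Fin (n + 1) → α) :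
          Fin (n + 2) → α) := by
      rw [← (Fin.consEquiv fun _ : Fin (n + 1) => α).sum_comp, Fintype.sum_prod_type]
      rfl
    calc _ = ∑ x, ∑ y, ∑ h : Fin n → α, wordSign (Fin.cons x (Fin.cons y h : Fin (n + 1) → α) :
            Fin (n + 2) → α) := Finset.sum_congr rfl fun x _ => hinner x
      _ = ∑ h : Fin n → α, ∑ x, ∑ y, wordSign (Fin.cons x (Fin.cons y h : Fin (n + 1) → α) :
            Fin (n + 2) → α) := by
          rw [Finset.sum_comm (s := (Finset.univ : Finset (Fin n → α)))]
          exact Finset.sum_congr rfl fun x _ => Finset.sum_comm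
      _ = ∑ h : Fin n → α, Fintype.card α * wordSign h := by
          refine Finset.sum_congr rfl fun h _ => ?_
          rw [← sum_sum_mul_eq_card (fun x => ∏ j, if x ≤ h j then (1 : ℤ) else -1) fun x => by
            rw [← Finset.prod_mul_distrib]
            exact Finset.prod_eq_one fun j _ => by split_ifs <;> rfl]
          simp only [wordSign_cons, Fin.prod_univ_succ, Fin.cons_zero, Fin.cons_succ,
            Finset.sum_mul]
          refine Finset.sum_congr rfl fun x _ => Finset.sum_congr rfl fun y _ => ?_
          ring
      _ = _ := by
          rw [← Finset.mul_sum, sum_wordSign α n, ← pow_succ']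
          congr 1
          omega

theorem card_strictMono (n m : ℕ) :
    (Finset.univ.filter fun f : Fin n → Fin m => StrictMono f).card = m.choose n := by
  have e : {f : Fin n → Fin m // StrictMono f} ≃ Set.powersetCard (Fin m) n :=
    (Equiv.mk (fun f => OrderEmbedding.ofStrictMono f.1 f.2) (fun f => ⟨f, f.strictMono⟩)
      (fun _ => rfl) (fun _ => rfl) :
      {f : Fin n → Fin m // StrictMono f} ≃ (Fin n ↪o Fin m)).trans
      Set.powersetCard.ofFinEmbEquiv
  rw [← Fintype.card_subtype, ← Nat.card_eq_fintype_card, Nat.card_congr e,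
    Set.powersetCard.card]
  simp

/-- The number of weakly increasing words of length `n + 1` in `a` letters that increase strictly at the positions satisfying `p`. -/
theorem card_strict_at (n a : ℕ) (p : ℕ → Prop) [DecidablePred p] :
    (Finset.univ.filter fun f : Fin (n + 1) → Fin a =>
      ∀ i : Fin n, f i.castSucc ≤ f i.succ ∧ (p i → f i.castSucc < f i.succ)).card =
      (a + Nat.count (fun k => ¬ p k) n).choose (n + 1) := by
  rw [← card_strictMono]
  set e : ℕ → ℕ := Nat.count fun k => ¬ p k with he
  have hsucc (i : ℕ) : e (i + 1) = e i + if p i then 0 else 1 := by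
    rw [he, Nat.count_succ]; split_ifs <;> simp_all
  have hmono : Monotone e := Nat.count_monotone _
  have hle (i : Fin (n + 1)) : e i ≤ e n := hmono (by omega)
  have hshift {h : Fin (n + 1) → Fin (a + e n)} (hh : StrictMono h) :
      Monotone fun i => ((h i : ℕ) : ℤ) - e i := by
    rw [Fin.monotone_iff_le_succ]
    intro i
    have h1 := hh (Fin.castSucc_lt_succ (i := i))
    have h2 := hsucc i
    simp only [Fin.lt_def, Fin.val_succ, Fin.val_castSucc] at h1 ⊢
    split_ifs at h2 <;> omega
  have hlow {h : Fin (n + 1) → Fin (a + e n)} (hh : StrictMono h) (i : Fin (n + 1)) :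
      e i ≤ h i := by
    have := hshift hh (Fin.zero_le i)
    have h0 : e 0 = 0 := Nat.count_zero _
    simp only [Fin.val_zero, h0] at this
    omega
  have hhigh {h : Fin (n + 1) → Fin (a + e n)} (hh : StrictMono h) (i : Fin (n + 1)) :
      h i - e i < a := by
    have := hshift hh (Fin.le_last i)
    have h1 := (h (Fin.last n)).2
    have h2 := hlow hh i
    simp only [Fin.val_last] at this
    omega
  refine Finset.card_bij'
    (fun f _ i => ⟨f i + e i, by have := (f i).2; have := hle i; omega⟩)
    (fun h hh i => ⟨h i - e i, hhigh (Finset.mem_filter.1 hh).2 i⟩) ?_ ?_ ?_ ?_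
  · intro f hf
    simp only [Finset.mem_filter, Finset.mem_univ, true_and] at hf ⊢
    rw [Fin.strictMono_iff_lt_succ]
    intro i
    obtain ⟨h1, h2⟩ := hf i
    have h3 := hsucc i
    simp only [Fin.lt_def, Fin.le_def, Fin.val_succ, Fin.val_castSucc] at h1 h2 ⊢
    split_ifs at h3 with hp
    · have := h2 hp
      omega
    · omega
  · intro h hh
    simp only [Finset.mem_filter, Finset.mem_univ, true_and] at hh ⊢
    intro i
    have h1 := hh (Fin.castSucc_lt_succ (i := i))
    have h2 := hlow hh i.castSucc
    have h3 := hlow hh i.succ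
    have h4 := hsucc i
    simp only [Fin.lt_def, Fin.le_def, Fin.val_succ, Fin.val_castSucc] at h1 h2 h3 ⊢
    split_ifs at h4 with hp
    · omega
    · exact ⟨by omega, fun hp' => absurd hp' hp⟩
  · intro f _
    ext i
    simp
  · intro h hh
    ext i
    simpa using Nat.sub_add_cancel (hlow (Finset.mem_filter.1 hh).2 i)

theorem sort_eq_iff_forall_succ {α : Type*} [LinearOrder α] {n : ℕ} (g : Fin (n + 1) → α)
    (u : Equiv.Perm (Fin (n + 1))) :
    Tuple.sort g = u ↔ ∀ i : Fin n, g (u i.castSucc) ≤ g (u i.succ) ∧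
      (u i.succ < u i.castSucc → g (u i.castSucc) < g (u i.succ)) := by
  rw [eq_comm, Tuple.eq_sort_iff', Fin.strictMono_iff_lt_succ]
  refine forall_congr' fun i => ?_
  change toLex (g (u i.castSucc), u i.castSucc) < toLex (g (u i.succ), u i.succ) ↔ _
  have hne : u i.castSucc ≠ u i.succ := fun h => (Fin.castSucc_lt_succ (i := i)).ne (u.injective h)
  rw [Prod.Lex.toLex_lt_toLex]
  constructor
  · rintro (h | ⟨h, h'⟩)
    · exact ⟨h.le, fun _ => h⟩
    · exact ⟨h.le, fun h'' => absurd h' h''.asymm⟩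
  · rintro ⟨h, h'⟩
    rcases hne.lt_or_gt with h'' | h''
    · exact h.lt_or_eq.imp id fun h => ⟨h, h''⟩
    · exact Or.inl (h' h'')

/-- The number of words of length `n` in `a` letters whose sorting permutation is `u`. -/
theorem card_sort_eq (n a : ℕ) (hn : 1 ≤ n) (u : Equiv.Perm (Fin n)) :
    (Finset.univ.filter fun g : Fin n → Fin a => Tuple.sort g = u).card =
      (n + a - desA u - 1).choose n := by
  obtain ⟨n, rfl⟩ := Nat.exists_eq_add_of_le' hn
  let p : ℕ → Prop := fun i => ∃ h : i + 1 < n + 1, u ⟨i + 1, h⟩ < u ⟨i, Nat.lt_of_succ_lt h⟩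
  have hpi (i : Fin n) : p i ↔ u i.succ < u i.castSucc :=
    ⟨fun ⟨_, h⟩ => h, fun h => ⟨Nat.succ_lt_succ i.2, h⟩⟩
  have hdes : desA u = Nat.count p n := by
    rw [Nat.count_eq_card_filter_range]
    unfold desA
    congr 1
  have hcount : Nat.count p n + Nat.count (fun k => ¬ p k) n = n := by
    rw [Nat.count_eq_card_filter_range, Nat.count_eq_card_filter_range,
      Finset.card_filter_add_card_filter_not, Finset.card_range]
  rw [show n + 1 + a - desA u - 1 = a + Nat.count (fun k => ¬ p k) n by omega,
    ← card_strict_at]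
  refine Finset.card_equiv (Equiv.arrowCongr u.symm (Equiv.refl _)) fun g => ?_
  simp [sort_eq_iff_forall_succ, hpi]

theorem sign_after_riffle_shuffle (n a : ℕ) (hn : 1 ≤ n) (ha : 1 ≤ a) :
    ∑ w ∈ Finset.univ.filter (fun w : Equiv.Perm (Fin n) => Equiv.Perm.sign w = 1),
        ((Nat.choose (n + a - desA w⁻¹ - 1) n : ℚ) / (a : ℚ) ^ n)
      = 1 / 2 + 1 / (2 * (a : ℚ) ^ (n / 2)) := by
  have hfiber : ∑ w : Equiv.Perm (Fin n), (1 + (Equiv.Perm.sign w : ℤ)) *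
      ((n + a - desA w⁻¹ - 1).choose n : ℤ) = (a : ℤ) ^ n + (a : ℤ) ^ ((n + 1) / 2) := by
    calc _ = ∑ u : Equiv.Perm (Fin n), (1 + (Equiv.Perm.sign u : ℤ)) *
          ((n + a - desA u - 1).choose n : ℤ) := by
          rw [← Equiv.sum_comp (Equiv.inv (Equiv.Perm (Fin n)))]
          simp
      _ = ∑ u : Equiv.Perm (Fin n), ∑ g : Fin n → Fin a with Tuple.sort g = u,
          (1 + (Equiv.Perm.sign (Tuple.sort g) : ℤ)) := by
          refine Finset.sum_congr rfl fun u _ => ?_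
          rw [Finset.sum_congr rfl fun g hg => by rw [(Finset.mem_filter.1 hg).2],
            Finset.sum_const, card_sort_eq n a hn, nsmul_eq_mul, mul_comm]
      _ = ∑ g : Fin n → Fin a, (1 + (Equiv.Perm.sign (Tuple.sort g) : ℤ)) :=
          Finset.sum_fiberwise _ _ _
      _ = _ := by
          simp [Finset.sum_add_distrib, sign_sort_eq_wordSign, sum_wordSign]
  have heven : (2 : ℤ) * ∑ w : Equiv.Perm (Fin n) with Equiv.Perm.sign w = 1,
      ((n + a - desA w⁻¹ - 1).choose n : ℤ) = (a : ℤ) ^ n + (a : ℤ) ^ ((n + 1) / 2) := by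
    rw [← hfiber, Finset.mul_sum, Finset.sum_filter]
    refine Finset.sum_congr rfl fun w _ => ?_
    rcases Int.units_eq_one_or (Equiv.Perm.sign w) with h | h <;> simp [h]
  have hq : (2 : ℚ) * ∑ w : Equiv.Perm (Fin n) with Equiv.Perm.sign w = 1,
      ((n + a - desA w⁻¹ - 1).choose n : ℚ) = (a : ℚ) ^ n + (a : ℚ) ^ ((n + 1) / 2) := by
    exact_mod_cast heven
  have ha0 : (a : ℚ) ≠ 0 := by positivity
  have hpow : (a : ℚ) ^ n = a ^ ((n + 1) / 2) * a ^ (n / 2) := by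
    rw [← pow_add]
    congr 1
    omega
  rw [← Finset.sum_div, div_eq_iff (pow_ne_zero n ha0)]
  have hsplit : 1 / (2 * (a : ℚ) ^ (n / 2)) * a ^ n = a ^ ((n + 1) / 2) / 2 := by
    rw [hpow]
    field_simp
  rw [add_mul, hsplit]
  linarith
end

section
/- For odd a ≥ 1 and n ≥ 1, the probability that a type B a-riffle shuffle started at the identity yields an element with sgn_B = 1 equals 1/2 + 1/(2a^n); that is, ∑_{w ∈ B_n, sgn_B(w)=1} C(n + (a-1)/2 - des_B(w^{-1}), n)/a^n = 1/2 + 1/(2a^n). -/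
open scoped Classical

/-- An element of the hyperoctahedral group `B_n`, encoded as an underlying
permutation `u ∈ S_n` together with the set of negated positions (`true` = negated). -/
abbrev BPerm (n : ℕ) := Equiv.Perm (Fin n) × (Fin n → Bool)

/-- The one-line value `w(i)` (as an integer, positions and values `1,…,n`)
of the signed permutation, with the convention `w(0) = 0`. -/
noncomputable def bval {n : ℕ} (p : BPerm n) (i : ℕ) : ℤ :=
  if h : 1 ≤ i ∧ i ≤ n then
    (if p.2 ⟨i - 1, by omega⟩ then -(((p.1 ⟨i - 1, by omega⟩ : Fin n) : ℕ) + 1 : ℤ)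
      else (((p.1 ⟨i - 1, by omega⟩ : Fin n) : ℕ) + 1 : ℤ))
  else 0

/-- The number of type B descents: `0 ≤ i ≤ n-1` with `w(i) > w(i+1)`, where `w(0)=0`. -/
noncomputable def desB {n : ℕ} (p : BPerm n) : ℕ :=
  ((Finset.range n).filter (fun i => bval p (i + 1) < bval p i)).card

/-- The sign character of `B_n`: `sgn_B(u^J) = (-1)^{|J|} sgn(u)`. -/
noncomputable def sgnB {n : ℕ} (p : BPerm n) : ℤ :=
  (Equiv.Perm.sign p.1 : ℤ) * (-1) ^ ((Finset.univ.filter (fun i => p.2 i = true)).card)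

/-- The inverse of a signed permutation `w = u^J`: its underlying permutation is
`u⁻¹` and position `j` is negated iff position `u⁻¹(j)` of `w` is negated. -/
noncomputable def invBPerm {n : ℕ} (p : BPerm n) : BPerm n :=
  (p.1⁻¹, fun i => p.2 (p.1⁻¹ i))

theorem alternating_sum_choose_mul_choose (n k : ℕ) :
    ∑ j ∈ Finset.range (n + 1), (-1 : ℤ) ^ j * n.choose j * (n + k - j).choose n = 1 := by
  have h := congrFun (fwdDiff_iter_choose 0 n) k
  rw [fwdDiff_iter_eq_sum_shift] at h
  simp only [add_zero, Nat.choose_zero_right, Nat.cast_one] at h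
  refine Eq.trans ?_ h
  rw [← Finset.sum_range_reflect]
  refine Finset.sum_congr rfl fun j hj => ?_
  have hj' : j ≤ n := by simpa [Nat.lt_succ_iff] using hj
  have h1 : n + 1 - 1 - j = n - j := by omega
  have h2 : n + k - (n - j) = k + j := by omega
  rw [h1, h2, Nat.choose_symm hj']
  simp

theorem card_strictMono_Icc (n N : ℕ) :
    ((Fintype.piFinset fun _ : Fin n => Finset.Icc (1 : ℤ) N).filter StrictMono).card
      = N.choose n := by
  have hN : N.choose n = ((Finset.Icc (1 : ℤ) N).powersetCard n).card := by simp
  rw [hN]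
  refine Finset.card_bij (fun e _ => Finset.univ.image e) ?_ ?_ ?_
  · intro e he
    simp only [Finset.mem_filter, Fintype.mem_piFinset] at he
    rw [Finset.mem_powersetCard, Finset.card_image_of_injective _ he.2.injective]
    refine ⟨?_, by simp⟩
    intro v hv
    obtain ⟨i, -, rfl⟩ := Finset.mem_image.1 hv
    exact he.1 i
  · intro e he e' he' h
    simp only [Finset.mem_filter] at he he'
    refine (StrictMono.range_inj he.2 he'.2).1 ?_
    simpa using congrArg (fun s : Finset ℤ => (s : Set ℤ)) h
  · intro s hs
    rw [Finset.mem_powersetCard] at hs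
    refine ⟨s.orderEmbOfFin hs.2, ?_, ?_⟩
    · simp only [Finset.mem_filter, Fintype.mem_piFinset]
      exact ⟨fun i => hs.1 (s.orderEmbOfFin_mem hs.2 i), (s.orderEmbOfFin hs.2).strictMono⟩
    · apply Finset.coe_injective
      simp

theorem bval_zero {n : ℕ} (p : BPerm n) : bval p 0 = 0 := by simp [bval]

theorem bval_succ {n : ℕ} (p : BPerm n) (i : Fin n) :
    bval p (i + 1) = if p.2 i then -((p.1 i : ℕ) + 1 : ℤ) else ((p.1 i : ℕ) + 1 : ℤ) := by
  have h : 1 ≤ (i : ℕ) + 1 ∧ (i : ℕ) + 1 ≤ n := ⟨by omega, i.2⟩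
  simp [bval, h]

theorem natAbs_bval_succ {n : ℕ} (p : BPerm n) (i : Fin n) :
    (bval p (i + 1)).natAbs = p.1 i + 1 := by
  rw [bval_succ]
  split <;> omega

/-- The number of type B non-descents among the positions `0, …, m - 1`. -/
noncomputable def ascB {n : ℕ} (p : BPerm n) (m : ℕ) : ℕ :=
  ((Finset.range m).filter (fun i => ¬ bval p (i + 1) < bval p i)).card

theorem ascB_zero {n : ℕ} (p : BPerm n) : ascB p 0 = 0 := by simp [ascB]

theorem ascB_succ {n : ℕ} (p : BPerm n) (m : ℕ) :
    ascB p (m + 1) = ascB p m + if bval p (m + 1) < bval p m then 0 else 1 := by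
  rw [ascB, Finset.range_add_one, Finset.filter_insert]
  split_ifs <;> simp_all [ascB]

theorem ascB_add_desB {n : ℕ} (p : BPerm n) : ascB p n + desB p = n := by
  have h := Finset.card_filter_add_card_filter_not (s := Finset.range n)
    (fun i => bval p (i + 1) < bval p i)
  rw [Finset.card_range] at h
  rw [ascB, desB]
  omega

/-- The key by which the coordinates of an integer vector are sorted: first by absolute value,
then by signed position. -/
def signedKey {n : ℕ} (x : Fin n → ℤ) (v : Fin n) : ℤ ×ₗ ℤ :=
  toLex (|x v|, if x v < 0 then -((v : ℕ) + 1 : ℤ) else ((v : ℕ) + 1 : ℤ))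

/-- The signed permutation `p` records the signs of `x` and sorts its coordinates. -/
def Sorts {n : ℕ} (p : BPerm n) (x : Fin n → ℤ) : Prop :=
  (∀ i, p.2 i = decide (x (p.1 i) < 0)) ∧ StrictMono (signedKey x ∘ p.1)

theorem signedKey_injective {n : ℕ} (x : Fin n → ℤ) : Function.Injective (signedKey x) := by
  intro v w h
  have h2 := congrArg (fun y => (ofLex y).2) h
  simp only [signedKey, ofLex_toLex] at h2
  ext
  split_ifs at h2 <;> omega

theorem existsUnique_sorts {n : ℕ} (x : Fin n → ℤ) : ∃! p : BPerm n, Sorts p x := by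
  refine ⟨(Tuple.sort (signedKey x), fun i => decide (x (Tuple.sort (signedKey x) i) < 0)),
    ⟨fun i => rfl, ?_⟩, ?_⟩
  · exact (Tuple.monotone_sort _).strictMono_of_injective
      ((signedKey_injective x).comp (Equiv.injective _))
  · rintro ⟨u, ε⟩ ⟨hs, hm⟩
    have hu : u = Tuple.sort (signedKey x) := by
      ext1 i
      exact signedKey_injective x
        (congrFun (Tuple.unique_monotone hm.monotone (Tuple.monotone_sort (signedKey x))) i)
    subst hu
    exact Prod.ext rfl (funext hs)

theorem sorts_iff {m : ℕ} (p : BPerm (m + 1)) (x : Fin (m + 1) → ℤ) :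
    Sorts p x ↔ (∀ i, p.2 i = decide (x (p.1 i) < 0)) ∧
      StrictMono fun i : Fin (m + 1) => |x (p.1 i)| + (ascB p (i + 1) : ℤ) := by
  refine and_congr_right fun hs => ?_
  have hkey : ∀ i, signedKey x (p.1 i) = toLex (|x (p.1 i)|, bval p (i + 1)) := by
    intro i
    rw [bval_succ, signedKey, hs i]
    simp
  rw [Fin.strictMono_iff_lt_succ, Fin.strictMono_iff_lt_succ]
  refine forall_congr' fun i => ?_
  have h1 := natAbs_bval_succ p i.castSucc
  have h2 := natAbs_bval_succ p i.succ
  have hne : (p.1 i.castSucc : ℕ) ≠ p.1 i.succ := by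
    intro h
    have := p.1.injective (Fin.ext h)
    simp [Fin.ext_iff] at this
  have h3 := ascB_succ p (i + 1)
  simp only [Function.comp, hkey, Prod.Lex.toLex_lt_toLex, Fin.val_castSucc, Fin.val_succ] at *
  split_ifs at h3 <;> omega

theorem card_sorts {m : ℕ} (p : BPerm (m + 1)) (k : ℕ) :
    ((Fintype.piFinset fun _ : Fin (m + 1) => Finset.Icc (-k : ℤ) k).filter (Sorts p)).card
      = (m + 1 + k - desB p).choose (m + 1) := by
  have hN : m + 1 + k - desB p = k + ascB p (m + 1) := by
    have := ascB_add_desB p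
    omega
  rw [hN, ← card_strictMono_Icc]
  have hstep : ∀ j : ℕ, ascB p (j + 1) = ascB p j + if bval p (j + 1) < bval p j then 0 else 1 :=
    ascB_succ p
  refine Finset.card_bij (fun x _ i => |x (p.1 i)| + (ascB p (i + 1) : ℤ)) ?_ ?_ ?_
  · intro x hx
    simp only [Finset.mem_filter, Fintype.mem_piFinset, Finset.mem_Icc, sorts_iff] at hx ⊢
    obtain ⟨hb, hs, hm⟩ := hx
    refine ⟨fun i => ⟨?_, ?_⟩, hm⟩
    · refine le_trans ?_ (hm.monotone (Fin.zero_le i))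
      have h0 := hstep 0
      have hv := bval_succ p 0
      have hs0 := hs 0
      simp only [Fin.val_zero, zero_add, bval_zero, ascB_zero] at *
      by_cases hx0 : x (p.1 0) < 0
      · have : 1 ≤ |x (p.1 0)| := Int.one_le_abs hx0.ne
        omega
      · simp only [hx0, decide_false] at hs0
        simp only [hs0] at hv
        have := abs_nonneg (x (p.1 0))
        split_ifs at h0 <;> simp at hv <;> omega
    · refine le_trans (hm.monotone (Fin.le_last i)) ?_
      have := abs_le.2 (hb (p.1 (Fin.last m)))
      simpa using this
  · intro x hx y hy h
    simp only [Finset.mem_filter, sorts_iff] at hx hy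
    ext v
    obtain ⟨i, rfl⟩ := p.1.surjective v
    have habs : |x (p.1 i)| = |y (p.1 i)| := by simpa using congrFun h i
    have hsgn : x (p.1 i) < 0 ↔ y (p.1 i) < 0 := by
      have := (hx.2.1 i).symm.trans (hy.2.1 i)
      simpa using this
    rcases abs_cases (x (p.1 i)) with ⟨h1, h2⟩ | ⟨h1, h2⟩ <;>
      rcases abs_cases (y (p.1 i)) with ⟨h3, h4⟩ | ⟨h3, h4⟩ <;> omega
  · intro e he
    simp only [Finset.mem_filter, Fintype.mem_piFinset, Finset.mem_Icc] at he
    obtain ⟨hb, hm⟩ := he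
    have hsucc := Fin.strictMono_iff_lt_succ.1 hm
    have hpos : ∀ i : Fin (m + 1), 0 ≤ e i - ascB p (i + 1) ∧
        (1 ≤ e i - ascB p (i + 1) ∨ 0 < bval p (i + 1)) := by
      intro i
      induction i using Fin.induction with
      | zero =>
        have h0 := hstep 0
        have h1 := natAbs_bval_succ p 0
        have h2 := (hb 0).1
        simp only [Fin.val_zero, zero_add, bval_zero, ascB_zero] at *
        split_ifs at h0 <;> omega
      | succ i ih =>
        have h0 := hstep (i + 1)
        have h2 := hsucc i
        simp only [Fin.val_castSucc, Fin.val_succ] at *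
        split_ifs at h0 <;> omega
    have hle : ∀ i : Fin (m + 1), e i - ascB p (i + 1) ≤ k := by
      intro i
      induction i using Fin.reverseInduction with
      | last =>
        have := (hb (Fin.last m)).2
        simp only [Fin.val_last]
        push_cast at this
        omega
      | cast i ih =>
        have h0 := hstep (i + 1)
        have h2 := hsucc i
        simp only [Fin.val_castSucc, Fin.val_succ] at *
        split_ifs at h0 <;> omega
    set x : Fin (m + 1) → ℤ := fun v =>
      if p.2 (p.1.symm v) then -(e (p.1.symm v) - ascB p (p.1.symm v + 1))
      else e (p.1.symm v) - ascB p (p.1.symm v + 1) with hx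
    have hxi : ∀ i, x (p.1 i) = if p.2 i then -(e i - ascB p (i + 1))
        else e i - ascB p (i + 1) := by
      intro i
      simp [hx]
    have habs : ∀ i, |x (p.1 i)| = e i - ascB p (i + 1) := by
      intro i
      rw [hxi]
      split_ifs
      · rw [abs_neg, abs_of_nonneg (hpos i).1]
      · rw [abs_of_nonneg (hpos i).1]
    have heq : (fun i : Fin (m + 1) => |x (p.1 i)| + (ascB p (i + 1) : ℤ)) = e := by
      ext i
      rw [habs]
      ring
    refine ⟨x, ?_, heq⟩
    simp only [Finset.mem_filter, Fintype.mem_piFinset, Finset.mem_Icc, sorts_iff]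
    refine ⟨fun v => ?_, fun i => ?_, heq ▸ hm⟩
    · obtain ⟨i, rfl⟩ := p.1.surjective v
      rw [← abs_le, habs]
      exact hle i
    · have h1 := hpos i
      have h2 := bval_succ p i
      rw [hxi]
      cases hp : p.2 i
      · simpa using h1.1
      · simp only [hp, if_true] at h2
        have : 1 ≤ e i - ascB p (i + 1) := by omega
        simp only [if_true]
        symm
        rw [decide_eq_true_iff]
        omega

theorem sum_choose_desB {n : ℕ} (hn : 1 ≤ n) (k : ℕ) :
    ∑ p : BPerm n, (n + k - desB p).choose n = (2 * k + 1) ^ n := by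
  obtain ⟨m, rfl⟩ : ∃ m, n = m + 1 := ⟨n - 1, by omega⟩
  have hcube : (Fintype.piFinset fun _ : Fin (m + 1) => Finset.Icc (-k : ℤ) k).card
      = (2 * k + 1) ^ (m + 1) := by
    rw [Fintype.card_piFinset_const, Int.card_Icc]
    congr 1
    omega
  have h := Finset.sum_card_bipartiteAbove_eq_sum_card_bipartiteBelow (s := Finset.univ)
    (t := Fintype.piFinset fun _ : Fin (m + 1) => Finset.Icc (-k : ℤ) k)
    (fun (p : BPerm (m + 1)) x => Sorts p x)
  simp only [Finset.bipartiteAbove, Finset.bipartiteBelow] at h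
  rw [← hcube, Finset.card_eq_sum_ones, ← Finset.sum_congr rfl fun p _ => card_sorts p k]
  refine h.trans (Finset.sum_congr rfl fun x _ => ?_)
  obtain ⟨p, hp, huniq⟩ := existsUnique_sorts x
  rw [Finset.card_eq_one]
  refine ⟨p, ?_⟩
  ext q
  simp only [Finset.mem_filter, Finset.mem_univ, true_and, Finset.mem_singleton]
  exact ⟨huniq q, fun h => h ▸ hp⟩

theorem sgnB_eq_mul_prod {n : ℕ} (p : BPerm n) :
    sgnB p = (Equiv.Perm.sign p.1 : ℤ) * ∏ i, if p.2 i = true then -1 else 1 := by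
  rw [sgnB, Finset.prod_ite, Finset.prod_const, Finset.prod_const_one, mul_one]

theorem sgnB_update_not {n : ℕ} (u : Equiv.Perm (Fin n)) (ε : Fin n → Bool) (a : Fin n) :
    sgnB (u, Function.update ε a (!ε a)) = -sgnB (u, ε) := by
  rw [sgnB_eq_mul_prod, sgnB_eq_mul_prod, ← mul_neg,
    ← Finset.mul_prod_erase _ _ (Finset.mem_univ a),
    ← Finset.mul_prod_erase _ (fun i => if ε i = true then (-1 : ℤ) else 1) (Finset.mem_univ a)]
  have h : ∀ i ∈ Finset.univ.erase a,
      (if Function.update ε a (!ε a) i = true then (-1 : ℤ) else 1)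
        = if ε i = true then -1 else 1 := by
    intro i hi
    rw [Function.update_of_ne (Finset.ne_of_mem_erase hi)]
  rw [Finset.prod_congr rfl h]
  cases ε a <;> simp

/-- Away from the identity, some sign can be flipped without changing the descents. -/
theorem exists_desB_update_not {n : ℕ} (u : Equiv.Perm (Fin n)) (hu : u ≠ 1) :
    ∃ a, ∀ ε : Fin n → Bool, desB (u, Function.update ε a (!ε a)) = desB (u, ε) := by
  have hne : ∃ v, u v ≠ v := by
    by_contra! h
    exact hu (Equiv.ext h)
  obtain ⟨v, hv, hmin⟩ := WellFounded.has_min (wellFounded_lt (α := Fin n)) {v | u v ≠ v} hne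
  have hfix : ∀ w, w < v → u w = w := by
    intro w hw
    by_contra h
    exact hmin w h hw
  have hgt : ∀ w, v ≤ w → w ≠ u.symm v → v < u w := by
    intro w hw hwa
    have h1 : u w ≠ v := fun h => hwa (by rw [← h]; simp)
    rcases lt_trichotomy (u w) v with h | h | h
    · have := u.injective (hfix _ h)
      rw [this] at h
      exact absurd hw (not_le.2 h)
    · exact absurd h h1
    · exact h
  have hva : v < u.symm v := by
    rcases lt_trichotomy v (u.symm v) with h | h | h
    · exact h
    · exact absurd (u.symm_apply_eq.1 h.symm).symm hv
    · have := hfix _ h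
      simp at this
      exact absurd this.symm h.ne'.symm
  refine ⟨u.symm v, fun ε => ?_⟩
  unfold desB
  congr 1
  refine Finset.filter_congr fun i hi => ?_
  rw [Finset.mem_range] at hi
  have hoff : ∀ w : Fin n, w ≠ u.symm v →
      bval (u, Function.update ε (u.symm v) (!ε (u.symm v))) (w + 1) = bval (u, ε) (w + 1) := by
    intro w hw
    rw [bval_succ, bval_succ]
    simp only [Function.update_of_ne hw]
  have habs : ∀ (δ : Fin n → Bool) (w : Fin n), (bval (u, δ) (w + 1)).natAbs = u w + 1 :=
    fun δ w => natAbs_bval_succ (u, δ) w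
  have hav : (u (u.symm v) : ℕ) = v := by simp
  rcases i with _ | j
  · have h := hoff ⟨0, hi⟩ fun h => by
      rw [← h] at hva
      exact absurd hva (Nat.not_lt_zero _)
    simp only [zero_add] at h
    simp only [zero_add, bval_zero, h]
  · have hj : j < n := by omega
    have e1 := habs (Function.update ε (u.symm v) (!ε (u.symm v))) ⟨j, hj⟩
    have e2 := habs (Function.update ε (u.symm v) (!ε (u.symm v))) ⟨j + 1, hi⟩
    have e3 := habs ε ⟨j, hj⟩
    have e4 := habs ε ⟨j + 1, hi⟩
    have o1 := hoff ⟨j, hj⟩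
    have o2 := hoff ⟨j + 1, hi⟩
    have g1 := hgt ⟨j, hj⟩
    have g2 := hgt ⟨j + 1, hi⟩
    simp only [ne_eq, Fin.ext_iff, Fin.le_def, Fin.lt_def] at o1 o2 g1 g2 hva e1 e2 e3 e4
    by_cases c1 : j = (u.symm v : ℕ)
    · have k1 : (u ⟨j, hj⟩ : ℕ) = v := by rw [← hav]; congr
      have := o2 (by omega)
      have := g2 (by omega) (by omega)
      omega
    · have := o1 c1
      by_cases c2 : j + 1 = (u.symm v : ℕ)
      · have k1 : (u ⟨j + 1, hi⟩ : ℕ) = v := by rw [← hav]; congr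
        have := g1 (by omega) c1
        omega
      · have := o2 c2
        omega

theorem desB_one {n : ℕ} (ε : Fin n → Bool) :
    desB (1, ε) = (Finset.univ.filter fun i => ε i = true).card := by
  have hstep : ∀ i : Fin n, bval (1, ε) (i + 1) < bval (1, ε) i ↔ ε i = true := by
    intro i
    have h1 := bval_succ (1, ε) i
    have h2 : (bval (1, ε) i).natAbs = i := by
      obtain ⟨i, hi⟩ := i
      rcases i with _ | j
      · simp [bval_zero]
      · exact natAbs_bval_succ (1, ε) ⟨j, by omega⟩
    simp only [Equiv.Perm.coe_one, id] at h1
    by_cases h : ε i = true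
    · simp only [h, if_true, iff_true] at h1 ⊢
      omega
    · simp only [h, Bool.false_eq_true, if_false, iff_false] at h1 ⊢
      omega
  rw [desB, Finset.card_filter, Finset.card_filter,
    ← Fin.sum_univ_eq_sum_range fun i => if bval (1, ε) (i + 1) < bval (1, ε) i then 1 else 0]
  simp only [hstep]

theorem sum_sgnB_mul_choose_desB (n k : ℕ) :
    ∑ p : BPerm n, sgnB p * ((n + k - desB p).choose n : ℤ) = 1 := by
  rw [Fintype.sum_prod_type, Finset.sum_eq_single 1]
  · simp only [sgnB, desB_one, Equiv.Perm.sign_one, Units.val_one, one_mul]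
    have h := Finset.sum_powerset_apply_card
      (fun j => (-1 : ℤ) ^ j * ((n + k - j).choose n : ℤ)) (x := (Finset.univ : Finset (Fin n)))
    rw [Finset.card_fin, Finset.powerset_univ] at h
    refine Eq.trans ?_ (h.trans ((Finset.sum_congr rfl fun j _ => ?_).trans
      (alternating_sum_choose_mul_choose n k)))
    · refine Finset.sum_bij' (fun ε _ => Finset.univ.filter fun i => ε i = true)
        (fun s _ i => decide (i ∈ s)) ?_ ?_ ?_ ?_ ?_ <;> simp
    · rw [nsmul_eq_mul]
      ring
  · intro u _ hu
    obtain ⟨a, ha⟩ := exists_desB_update_not u hu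
    refine Finset.sum_involution (fun ε _ => Function.update ε a (!ε a)) ?_ ?_ ?_ ?_
    · intro ε _
      rw [ha, sgnB_update_not]
      ring
    · intro ε _ _ h
      have := congrFun h a
      simp at this
    · simp
    · simp
  · simp

theorem sgnB_invBPerm {n : ℕ} (p : BPerm n) : sgnB (invBPerm p) = sgnB p := by
  rw [sgnB_eq_mul_prod, sgnB_eq_mul_prod]
  refine congrArg₂ _ ?_ (Equiv.prod_comp p.1⁻¹ fun i => if p.2 i = true then (-1 : ℤ) else 1)
  simp [invBPerm]

theorem invBPerm_involutive {n : ℕ} : Function.Involutive (invBPerm (n := n)) := by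
  intro p
  ext <;> simp [invBPerm]

theorem sgnB_eq_one_or {n : ℕ} (p : BPerm n) : sgnB p = 1 ∨ sgnB p = -1 := by
  rw [sgnB]
  rcases Int.units_eq_one_or (Equiv.Perm.sign p.1) with h | h <;>
    rcases neg_one_pow_eq_or ℤ (Finset.univ.filter fun i => p.2 i = true).card with h' | h' <;>
    simp [h, h']

theorem typeB_sign_after_shuffle (n a : ℕ) (hn : 1 ≤ n) (ha : Odd a) (ha1 : 1 ≤ a) :
    ∑ p ∈ Finset.univ.filter (fun p : BPerm n => sgnB p = 1),
        ((Nat.choose (n + (a - 1) / 2 - desB (invBPerm p)) n : ℚ) / (a : ℚ) ^ n)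
      = 1 / 2 + 1 / (2 * (a : ℚ) ^ n) := by
  obtain ⟨k, rfl⟩ := ha
  have hk : (2 * k + 1 - 1) / 2 = k := by omega
  rw [hk, Finset.sum_filter]
  have hterm : ∀ p : BPerm n,
      (if sgnB p = 1 then
        ((n + k - desB (invBPerm p)).choose n : ℚ) / ((2 * k + 1 : ℕ) : ℚ) ^ n else 0)
      = (((n + k - desB (invBPerm p)).choose n : ℚ)
        + (sgnB (invBPerm p) : ℚ) * ((n + k - desB (invBPerm p)).choose n : ℚ))
          / (2 * ((2 * k + 1 : ℕ) : ℚ) ^ n) := by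
    intro p
    rw [sgnB_invBPerm]
    rcases sgnB_eq_one_or p with h | h
    · rw [if_pos h, h]
      field_simp
      push_cast
      ring
    · rw [if_neg (by omega), h]
      push_cast
      ring
  rw [Finset.sum_congr rfl fun p _ => hterm p]
  rw [(invBPerm_involutive (n := n)).bijective.sum_comp fun p : BPerm n =>
    (((n + k - desB p).choose n : ℚ) + (sgnB p : ℚ) * ((n + k - desB p).choose n : ℚ))
      / (2 * ((2 * k + 1 : ℕ) : ℚ) ^ n)]
  rw [← Finset.sum_div, Finset.sum_add_distrib]
  have h1 : ∑ p : BPerm n, ((n + k - desB p).choose n : ℚ) = ((2 * k + 1 : ℕ) : ℚ) ^ n := by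
    exact_mod_cast sum_choose_desB hn k
  have h2 : ∑ p : BPerm n, (sgnB p : ℚ) * ((n + k - desB p).choose n : ℚ) = 1 := by
    exact_mod_cast sum_sgnB_mul_choose_desB n k
  rw [h1, h2]
  have h3 : ((2 * k + 1 : ℕ) : ℚ) ^ n ≠ 0 := by positivity
  field_simp
end
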